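/- arXiv:2303.11489 — 2 statements merged into one kernel-verified Lean document; each statement's English description precedes it below -/
import Mathlib

section
/- Let N̄ be a symmetric (n+(n+m))×(n+(n+m)) real matrix with blocks N̄₁₁ ∈ ℝ^{n×n}, N̄₁₂ = N̄₂₁ᵀ ∈ ℝ^{n×(n+m)}, N̄₂₂ ∈ ℝ^{(n+m)×(n+m)}, and suppose N̄₂₂ ≺ 0. Then the set { (A,B) ∈ ℝ^{n×n} × ℝ^{n×m} : [I_n; Aᵀ; Bᵀ]ᵀ N̄ [I_n; Aᵀ; Bᵀ] ⪰ 0 } is nonempty if and only if N̄₁₁ − N̄₁₂ N̄₂₂⁻¹ N̄₂₁ ⪰ 0. -/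
open Matrix

theorem qmi_completion {n m : ℕ}
    (N11 : Matrix (Fin n) (Fin n) ℝ) (N12 : Matrix (Fin n) (Fin n ⊕ Fin m) ℝ)
    (N22 : Matrix (Fin n ⊕ Fin m) (Fin n ⊕ Fin m) ℝ)
    (h22 : N22.IsSymm) (hu : IsUnit N22.det) (Z : Matrix (Fin n ⊕ Fin m) (Fin n) ℝ) :
    (Matrix.fromRows (1 : Matrix (Fin n) (Fin n) ℝ) Z)ᵀ *
        Matrix.fromBlocks N11 N12 N12ᵀ N22 *
        Matrix.fromRows (1 : Matrix (Fin n) (Fin n) ℝ) Z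
      + (Z + N22⁻¹ * N12ᵀ)ᵀ * (-N22) * (Z + N22⁻¹ * N12ᵀ)
      = N11 - N12 * N22⁻¹ * N12ᵀ := by
  have hi : (N22⁻¹)ᵀ = N22⁻¹ := by rw [Matrix.transpose_nonsing_inv, h22.eq]
  have e1 : N22 * (N22⁻¹ * N12ᵀ) = N12ᵀ := Matrix.mul_nonsing_inv_cancel_left _ _ hu
  have e2 : N22⁻¹ * (N22 * Z) = Z := Matrix.nonsing_inv_mul_cancel_left _ _ hu
  rw [Matrix.transpose_fromRows, Matrix.fromCols_mul_fromBlocks, Matrix.fromCols_mul_fromRows]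
  simp only [Matrix.transpose_add, Matrix.transpose_mul, Matrix.transpose_transpose, hi,
    Matrix.transpose_one, Matrix.add_mul, Matrix.mul_add, Matrix.one_mul, Matrix.mul_one,
    Matrix.mul_neg, Matrix.neg_mul, Matrix.mul_assoc, e1, e2]
  abel


/-- spectral test. For a symmetric matrix `N̄` (partitioned conformably with
`[I_n; Aᵀ; Bᵀ]`) with `N̄₂₂ ≺ 0`, the set of `(A,B)` satisfying the quadratic matrix inequality
`[I_n; Aᵀ; Bᵀ]ᵀ N̄ [I_n; Aᵀ; Bᵀ] ⪰ 0` is nonempty if and only if the Schur complement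
`N̄₁₁ − N̄₁₂ N̄₂₂⁻¹ N̄₂₁` is positive semidefinite. -/
theorem qmiSet_nonempty_iff_schur {n m : ℕ}
    (N11 : Matrix (Fin n) (Fin n) ℝ) (N12 : Matrix (Fin n) (Fin n ⊕ Fin m) ℝ)
    (N22 : Matrix (Fin n ⊕ Fin m) (Fin n ⊕ Fin m) ℝ)
    (h11 : N11.IsSymm) (h22 : N22.IsSymm) (hneg : (-N22).PosDef) :
    {p : Matrix (Fin n) (Fin n) ℝ × Matrix (Fin n) (Fin m) ℝ |
      ((Matrix.fromRows (1 : Matrix (Fin n) (Fin n) ℝ) (Matrix.fromRows p.1ᵀ p.2ᵀ))ᵀ *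
        Matrix.fromBlocks N11 N12 N12ᵀ N22 *
        Matrix.fromRows (1 : Matrix (Fin n) (Fin n) ℝ)
          (Matrix.fromRows p.1ᵀ p.2ᵀ)).PosSemidef}.Nonempty ↔
    (N11 - N12 * N22⁻¹ * N12ᵀ).PosSemidef := by
  have hu : IsUnit N22.det := by
    have h := (Matrix.isUnit_iff_isUnit_det _).1 hneg.isUnit
    rw [Matrix.det_neg] at h
    exact isUnit_of_mul_isUnit_right h
  constructor
  · rintro ⟨p, hp⟩
    rw [← qmi_completion N11 N12 N22 h22 hu (Matrix.fromRows p.1ᵀ p.2ᵀ)]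
    refine Matrix.PosSemidef.add hp ?_
    have := hneg.posSemidef.conjTranspose_mul_mul_same
      (Matrix.fromRows p.1ᵀ p.2ᵀ + N22⁻¹ * N12ᵀ)
    rwa [Matrix.conjTranspose_eq_transpose_of_trivial] at this
  · intro h
    refine ⟨((Matrix.toRows₁ (-(N22⁻¹ * N12ᵀ)))ᵀ, (Matrix.toRows₂ (-(N22⁻¹ * N12ᵀ)))ᵀ), ?_⟩
    rw [← qmi_completion N11 N12 N22 h22 hu (-(N22⁻¹ * N12ᵀ))] at h
    simpa only [Set.mem_setOf_eq, Matrix.transpose_transpose, Matrix.fromRows_toRows,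
      neg_add_cancel, Matrix.mul_zero, add_zero] using h
end

section
/- Let η ∈ [0,1], T₀ ≥ 0, and let M: ℕ → ℕ be nondecreasing with M(0) = 0 and M(t+1) − M(t) ∈ {0,1} for all t, satisfying the average activation-time bound M(t_b) − M(t_a) ≤ T₀ + η (t_b − t_a) for all natural numbers t_a < t_b. Define τ_a(t) := T₀ + min_{0 ≤ s ≤ t} (M(s) − η s) − (M(t) − η t). Then: (i) 0 ≤ τ_a(t) ≤ T₀ for all t ∈ ℕ; (ii) if M(t+1) = M(t) + 1 then τ_a(t+1) = τ_a(t) + η − 1; (iii) if M(t+1) = M(t) then τ_a(t) ≤ τ_a(t+1) ≤ τ_a(t) + η. -/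
/-- the discrete activation-time timer. Given a counter `M` of time spent in mode
detection phases satisfying the average activation-time bound with parameters `η ∈ [0,1]` and
`T₀ ≥ 0`, the timer `τ_a(t) := T₀ + min_{0 ≤ s ≤ t}(M(s) − ηs) − (M(t) − ηt)` takes values in
`[0, T₀]`, decreases by `1 − η` during mode detection, and otherwise increases by at most `η`. -/
theorem activation_time_timer (η T₀ : ℝ) (hη0 : 0 ≤ η) (hη1 : η ≤ 1) (hT₀ : 0 ≤ T₀)
    (M : ℕ → ℕ) (hmono : Monotone M) (h0 : M 0 = 0)
    (hstep : ∀ t : ℕ, M (t + 1) = M t ∨ M (t + 1) = M t + 1)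
    (haat : ∀ ta tb : ℕ, ta < tb →
      (M tb : ℝ) - (M ta : ℝ) ≤ T₀ + η * ((tb : ℝ) - (ta : ℝ)))
    (τa : ℕ → ℝ)
    (hτa : ∀ t : ℕ, τa t =
      T₀ + ((Finset.range (t + 1)).inf' ⟨0, Finset.mem_range.mpr (Nat.succ_pos t)⟩
          fun s => (M s : ℝ) - η * (s : ℝ)) - ((M t : ℝ) - η * (t : ℝ))) :
    (∀ t : ℕ, 0 ≤ τa t ∧ τa t ≤ T₀) ∧
    (∀ t : ℕ, M (t + 1) = M t + 1 → τa (t + 1) = τa t + η - 1) ∧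
    (∀ t : ℕ, M (t + 1) = M t → τa t ≤ τa (t + 1) ∧ τa (t + 1) ≤ τa t + η) := by
  obtain ⟨m, hm⟩ : ∃ m : ℕ → ℝ, ∀ t : ℕ, m t =
      (Finset.range (t + 1)).inf' ⟨0, Finset.mem_range.mpr (Nat.succ_pos t)⟩
          fun s => (M s : ℝ) - η * (s : ℝ) := ⟨_, fun _ => rfl⟩
  have hle : ∀ t s : ℕ, s ≤ t → m t ≤ (M s : ℝ) - η * (s : ℝ) := by
    intro t s hs
    rw [hm]
    exact Finset.inf'_le (fun s : ℕ => (M s : ℝ) - η * (s : ℝ))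
      (Finset.mem_range.mpr (Nat.lt_succ_of_le hs))
  have hex : ∀ t : ℕ, ∃ s : ℕ, s ≤ t ∧ m t = (M s : ℝ) - η * (s : ℝ) := by
    intro t
    obtain ⟨s, hs, h⟩ := Finset.exists_mem_eq_inf'
      (⟨0, Finset.mem_range.mpr (Nat.succ_pos t)⟩ : (Finset.range (t + 1)).Nonempty)
      (fun s : ℕ => (M s : ℝ) - η * (s : ℝ))
    exact ⟨s, Nat.le_of_lt_succ (Finset.mem_range.mp hs), (hm t).trans h⟩
  have hτ : ∀ t : ℕ, τa t = T₀ + m t - ((M t : ℝ) - η * (t : ℝ)) := by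
    intro t
    rw [hτa, hm]
  have hanti : ∀ t : ℕ, m (t + 1) ≤ m t := by
    intro t
    obtain ⟨s, hs, h⟩ := hex t
    rw [h]
    exact hle _ _ (by omega)
  refine ⟨fun t => ⟨?_, ?_⟩, fun t ht => ?_, fun t ht => ?_⟩
  · obtain ⟨s, hs, h⟩ := hex t
    rw [hτ, h]
    rcases hs.eq_or_lt with rfl | hlt
    · linarith
    · have := haat s t hlt
      linarith
  · rw [hτ]
    linarith [hle t t le_rfl]
  · have h1 : m (t + 1) = m t := by
      refine le_antisymm (hanti t) ?_
      obtain ⟨s, hs, h⟩ := hex (t + 1)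
      rw [h]
      rcases hs.eq_or_lt with rfl | hlt
      · have := hle t t le_rfl
        rw [ht]
        push_cast
        linarith
      · exact hle _ _ (by omega)
    rw [hτ, hτ, h1, ht]
    push_cast
    ring
  · have h1 : m t - η ≤ m (t + 1) := by
      obtain ⟨s, hs, h⟩ := hex (t + 1)
      rw [h]
      rcases hs.eq_or_lt with rfl | hlt
      · have := hle t t le_rfl
        rw [ht]
        push_cast
        linarith
      · linarith [hle t s (by omega)]
    have h2 := hanti t
    rw [hτ, hτ, ht]
    push_cast
    constructor <;> linarith
end
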